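/- arXiv:math/0109118 — 2 statements merged into one kernel-verified Lean document; each statement's English description precedes it below -/
import Mathlib

section
/- (Cohn) For every associative unital ring R and every set σ of R-linear maps between finitely generated projective left R-modules, there exists a universally σ-inverting ring homomorphism f : R → σ⁻¹R; that is, f is σ-inverting, and for every σ-inverting ring homomorphism g : R → T there is a unique ring homomorphism h : σ⁻¹R → T with g = h ∘ f. -/
open MulOpposite

universe u

section BTensorCore

variable (R : Type u) [Ring R]
variable (M : Type u) [AddCommGroup M] [Module Rᵐᵒᵖ M]
variable (N : Type u) [AddCommGroup N] [Module R N]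

/-- The subgroup of relations defining the balanced tensor product `M ⊗_R N`. -/
noncomputable def btRel : AddSubgroup (TensorProduct ℤ M N) :=
  AddSubgroup.closure
    { x | ∃ (m : M) (r : R) (n : N), x = (op r • m) ⊗ₜ[ℤ] n - m ⊗ₜ[ℤ] (r • n) }

/-- The balanced tensor product `M ⊗_R N` of a right `R`-module `M` and a left `R`-module `N`:
the quotient of `M ⊗_ℤ N` by the relations `(m · r) ⊗ n = m ⊗ (r · n)`. -/
abbrev BTensor : Type u := TensorProduct ℤ M N ⧸ btRel R M N

variable {R M N}

/-- The image of `m ⊗ n` in `M ⊗_R N`. -/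
noncomputable def BTensor.tmul (m : M) (n : N) : BTensor R M N :=
  QuotientAddGroup.mk (m ⊗ₜ[ℤ] n)

variable {A : Type u} [AddCommGroup A]

/-- Lift a balanced biadditive map `M → N → A` to `M ⊗_R N → A`. -/
noncomputable def BTensor.lift (b : M →+ N →+ A)
    (hb : ∀ (r : R) (m : M) (n : N), b (op r • m) n = b m (r • n)) :
    BTensor R M N →+ A :=
  QuotientAddGroup.lift (btRel R M N)
    (TensorProduct.liftAddHom b (fun z m n => by
      simp [map_zsmul]))
    ((AddSubgroup.closure_le _).mpr (by
      rintro y ⟨m, r, n, rfl⟩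
      simp [AddMonoidHom.mem_ker, hb r m n]))

/-- Lift a balanced biadditive map given as a bare function. -/
noncomputable def BTensor.lift' (b : M → N → A)
    (h1 : ∀ m m' n, b (m + m') n = b m n + b m' n)
    (h2 : ∀ m n n', b m (n + n') = b m n + b m n')
    (hb : ∀ (r : R) m n, b (op r • m) n = b m (r • n)) :
    BTensor R M N →+ A :=
  BTensor.lift (AddMonoidHom.mk' (fun m => AddMonoidHom.mk' (b m) (h2 m))
    (fun m m' => AddMonoidHom.ext fun n => h1 m m' n)) hb

section MapRight

variable {N' : Type u} [AddCommGroup N'] [Module R N']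

/-- The map `1 ⊗ g : M ⊗_R N → M ⊗_R N'` induced by a map `g` of left `R`-modules. -/
noncomputable def BTensor.mapRight (g : N →ₗ[R] N') : BTensor R M N →+ BTensor R M N' :=
  QuotientAddGroup.map _ _
    (TensorProduct.map (LinearMap.id (R := ℤ) (M := M)) g.toAddMonoidHom.toIntLinearMap).toAddMonoidHom
    ((AddSubgroup.closure_le _).mpr (by
      rintro y ⟨m, r, n, rfl⟩
      refine AddSubgroup.mem_comap.mpr (AddSubgroup.subset_closure ?_)
      exact ⟨m, r, g n, by simp⟩))

end MapRight

section MapLeft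

variable {M' : Type u} [AddCommGroup M'] [Module Rᵐᵒᵖ M']

/-- The map `g ⊗ 1 : M ⊗_R N → M' ⊗_R N` induced by a map `g` of right `R`-modules. -/
noncomputable def BTensor.mapLeft (g : M →ₗ[Rᵐᵒᵖ] M') : BTensor R M N →+ BTensor R M' N :=
  QuotientAddGroup.map _ _
    (TensorProduct.map g.toAddMonoidHom.toIntLinearMap (LinearMap.id (R := ℤ) (M := N))).toAddMonoidHom
    ((AddSubgroup.closure_le _).mpr (by
      rintro y ⟨m, r, n, rfl⟩
      refine AddSubgroup.mem_comap.mpr (AddSubgroup.subset_closure ?_)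
      exact ⟨g m, r, n, by simp⟩))

end MapLeft

end BTensorCore

section Localization

variable {R : Type u} [Ring R] {ι : Type u}
  {P Q : ι → Type u}
  [∀ i, AddCommGroup (P i)] [∀ i, Module R (P i)]
  [∀ i, AddCommGroup (Q i)] [∀ i, Module R (Q i)]

/-- A ring homomorphism `f : R → S`, together with a right `R`-module structure on `S`, is
`σ`-inverting if the right `R`-action on `S` is the one induced by `f` (i.e. `x • r = x * f r`)
and, for every `s i : P i → Q i` in `σ`, the induced map
`1 ⊗ s i : S ⊗_R P i → S ⊗_R Q i` is bijective. -/
def IsInvertingHom (s : ∀ i, P i →ₗ[R] Q i) (S : Type u) [Ring S] [Module Rᵐᵒᵖ S]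
    (f : R →+* S) : Prop :=
  (∀ (r : R) (x : S), op r • x = x * f r) ∧
    ∀ i, Function.Bijective (BTensor.mapRight (M := S) (s i))

/-- `f : R → S` is universally `σ`-inverting if it is `σ`-inverting and every `σ`-inverting
ring homomorphism `g : R → T` factors through `f` by a unique ring homomorphism `S → T`. -/
def IsUniversalInverting (s : ∀ i, P i →ₗ[R] Q i) (S : Type u) [Ring S] [Module Rᵐᵒᵖ S]
    (f : R →+* S) : Prop :=
  IsInvertingHom s S f ∧
    ∀ (T : Type u) (_ : Ring T) (_ : Module Rᵐᵒᵖ T) (g : R →+* T),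
      IsInvertingHom s T g → ∃! h : S →+* T, g = h.comp f

end Localization

section BTensorLemmas

variable {R : Type u} [Ring R]
variable {M : Type u} [AddCommGroup M] [Module Rᵐᵒᵖ M]
variable {N N' : Type u} [AddCommGroup N] [Module R N] [AddCommGroup N'] [Module R N']
variable {A : Type u} [AddCommGroup A]

namespace BTensor

theorem add_tmul (m m' : M) (n : N) :
    tmul (R := R) (m + m') n = tmul m n + tmul m' n := by
  simp only [tmul, TensorProduct.add_tmul]
  rfl

theorem tmul_add (m : M) (n n' : N) :
    tmul (R := R) m (n + n') = tmul m n + tmul m n' := by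
  simp only [tmul, TensorProduct.tmul_add]
  rfl

theorem smul_tmul (r : R) (m : M) (n : N) :
    tmul (R := R) (op r • m) n = tmul m (r • n) := by
  rw [tmul, tmul, ← sub_eq_zero, ← QuotientAddGroup.mk_sub, QuotientAddGroup.eq_zero_iff]
  exact AddSubgroup.subset_closure ⟨m, r, n, rfl⟩

theorem sum_tmul {κ : Type*} (t : Finset κ) (m : κ → M) (n : N) :
    tmul (R := R) (∑ k ∈ t, m k) n = ∑ k ∈ t, tmul (m k) n :=
  map_sum (AddMonoidHom.mk' (fun m : M => tmul (R := R) m n) fun _ _ => add_tmul _ _ _) m t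

theorem tmul_sum {κ : Type*} (t : Finset κ) (m : M) (n : κ → N) :
    tmul (R := R) m (∑ k ∈ t, n k) = ∑ k ∈ t, tmul m (n k) :=
  map_sum (AddMonoidHom.mk' (fun n : N => tmul (R := R) m n) fun _ _ => tmul_add _ _ _) n t

@[simp]
theorem mapRight_tmul (g : N →ₗ[R] N') (m : M) (n : N) :
    mapRight g (tmul (R := R) m n) = tmul m (g n) := rfl

@[simp]
theorem mapLeft_tmul {M' : Type u} [AddCommGroup M'] [Module Rᵐᵒᵖ M'] (g : M →ₗ[Rᵐᵒᵖ] M')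
    (m : M) (n : N) : mapLeft g (tmul (R := R) m n) = tmul (g m) n := rfl

@[simp]
theorem lift'_tmul (b : M → N → A) (h1 h2 hb) (m : M) (n : N) :
    lift' (R := R) b h1 h2 hb (tmul m n) = b m n :=
  rfl

theorem addHom_ext {f g : BTensor R M N →+ A} (h : ∀ m n, f (tmul m n) = g (tmul m n)) :
    f = g := by
  refine QuotientAddGroup.addMonoidHom_ext _ (AddMonoidHom.ext fun x => ?_)
  induction x using TensorProduct.induction_on with
  | zero => simp only [map_zero]
  | tmul m n => exact h m n
  | add x y hx hy => simp only [map_add, hx, hy]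

end BTensor

end BTensorLemmas

theorem exists_finite_dual_basis (R : Type*) [Ring R] (P : Type*) [AddCommGroup P] [Module R P]
    [Module.Finite R P] [Module.Projective R P] :
    ∃ (n : ℕ) (p : Fin n → P) (φ : Fin n → P →ₗ[R] R), ∀ x, ∑ j, φ j x • p j = x := by
  obtain ⟨n, f, g, -, -, hfg⟩ := Module.Finite.exists_comp_eq_id_of_projective R P
  refine ⟨n, fun j => f (Pi.single j 1), fun j => LinearMap.proj j ∘ₗ g, fun x => ?_⟩
  simp_rw [LinearMap.comp_apply, LinearMap.proj_apply, ← map_smul, ← map_sum,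
    ← pi_eq_sum_univ']
  exact LinearMap.congr_fun hfg x

section InverseEntries

variable {R : Type u} [Ring R]
variable {P Q : Type u} [AddCommGroup P] [Module R P] [AddCommGroup Q] [Module R Q]

/-- A function `t : Q → P^* → S` behaving like `t q φ = (1 ⊗ φ) ((1 ⊗ s)⁻¹ (1 ⊗ q))`, i.e. like the
coordinates of an inverse of `1 ⊗ s : S ⊗_R P → S ⊗_R Q`. -/
structure IsInverseEntries (s : P →ₗ[R] Q) {S : Type u} [Ring S] (f : R →+* S)
    (t : Q → (P →ₗ[R] R) → S) : Prop where
  add_left : ∀ q q' φ, t (q + q') φ = t q φ + t q' φ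
  smul_left : ∀ r q φ, t (r • q) φ = f r * t q φ
  add_right : ∀ q φ φ', t q (φ + φ') = t q φ + t q φ'
  smul_right : ∀ r q φ, t q (op r • φ) = t q φ * f r
  comp_right : ∀ q (ψ : Q →ₗ[R] R), t q (ψ ∘ₗ s) = f (ψ q)
  map_left : ∀ p φ, t (s p) φ = f (φ p)

namespace IsInverseEntries

variable {s : P →ₗ[R] Q} {S : Type u} [Ring S] {f : R →+* S} {t : Q → (P →ₗ[R] R) → S}

theorem comp (ht : IsInverseEntries s f t) {T : Type u} [Ring T] (h : S →+* T) :
    IsInverseEntries s (h.comp f) (fun q φ => h (t q φ)) where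
  add_left q q' φ := by rw [ht.add_left, map_add]
  smul_left r q φ := by rw [ht.smul_left, map_mul, RingHom.comp_apply]
  add_right q φ φ' := by rw [ht.add_right, map_add]
  smul_right r q φ := by rw [ht.smul_right, map_mul, RingHom.comp_apply]
  comp_right q ψ := by rw [ht.comp_right, RingHom.comp_apply]
  map_left p φ := by rw [ht.map_left, RingHom.comp_apply]

theorem sum_right (ht : IsInverseEntries s f t) {κ : Type*} (u : Finset κ) (q : Q)
    (φ : κ → P →ₗ[R] R) : t q (∑ k ∈ u, φ k) = ∑ k ∈ u, t q (φ k) :=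
  map_sum (AddMonoidHom.mk' (t q) (ht.add_right q)) φ u

theorem sum_mul (ht : IsInverseEntries s f t) {κ : Type*} [Fintype κ] {p : κ → P}
    {φ : κ → P →ₗ[R] R} (hp : ∀ x, ∑ j, φ j x • p j = x) (q : Q) (χ : P →ₗ[R] R) :
    ∑ j, t q (φ j) * f (χ (p j)) = t q χ := by
  simp_rw [← ht.smul_right, ← ht.sum_right]
  congr 1
  ext x
  conv_rhs => rw [← hp x]
  simp

variable [Module Rᵐᵒᵖ S]

theorem mapRight_sum [Module.Finite R Q] [Module.Projective R Q] (ht : IsInverseEntries s f t)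
    (hf : ∀ (r : R) (x : S), op r • x = x * f r) {κ : Type*} [Fintype κ] {p : κ → P}
    {φ : κ → P →ₗ[R] R} (hp : ∀ x, ∑ j, φ j x • p j = x) (x : S) (q : Q) :
    BTensor.mapRight s (∑ j, BTensor.tmul (R := R) (x * t q (φ j)) (p j)) =
      BTensor.tmul x q := by
  obtain ⟨n, e, ψ, he⟩ := exists_finite_dual_basis R Q
  have key (k) : ∑ j, x * t q (φ j) * f (ψ k (s (p j))) = x * f (ψ k q) := by
    simp_rw [mul_assoc, ← Finset.mul_sum]
    rw [← ht.comp_right, ← ht.sum_mul hp q (ψ k ∘ₗ s)]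
    rfl
  calc
    _ = ∑ j, ∑ k, BTensor.tmul (R := R) (x * t q (φ j) * f (ψ k (s (p j)))) (e k) := by
      simp_rw [map_sum, BTensor.mapRight_tmul, ← hf, BTensor.smul_tmul, ← BTensor.tmul_sum, he]
    _ = ∑ k, BTensor.tmul (R := R) (x * f (ψ k q)) (e k) := by
      rw [Finset.sum_comm]
      simp_rw [← BTensor.sum_tmul, key]
    _ = BTensor.tmul x q := by
      simp_rw [← hf, BTensor.smul_tmul, ← BTensor.tmul_sum, he]

theorem bijective [Module.Finite R P] [Module.Projective R P] [Module.Finite R Q]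
    [Module.Projective R Q] (ht : IsInverseEntries s f t)
    (hf : ∀ (r : R) (x : S), op r • x = x * f r) :
    Function.Bijective (BTensor.mapRight (M := S) s) := by
  obtain ⟨n, p, φ, hp⟩ := exists_finite_dual_basis R P
  let τ : BTensor R S Q →+ BTensor R S P :=
    BTensor.lift' (fun x q => ∑ j, BTensor.tmul (x * t q (φ j)) (p j))
      (fun x x' q => by simp_rw [add_mul, BTensor.add_tmul, Finset.sum_add_distrib])
      (fun x q q' => by
        simp_rw [ht.add_left, mul_add, BTensor.add_tmul, Finset.sum_add_distrib])
      (fun r x q => by simp_rw [hf, ht.smul_left, mul_assoc])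
  refine Function.bijective_iff_has_inverse.mpr ⟨τ, fun y => ?_, fun y => ?_⟩
  · suffices h : τ.comp (BTensor.mapRight s) = AddMonoidHom.id _ from DFunLike.congr_fun h y
    refine BTensor.addHom_ext fun x q => ?_
    simp only [τ, AddMonoidHom.comp_apply, BTensor.mapRight_tmul, BTensor.lift'_tmul,
      AddMonoidHom.id_apply, ht.map_left]
    simp_rw [← hf, BTensor.smul_tmul, ← BTensor.tmul_sum, hp]
  · suffices h : (BTensor.mapRight s).comp τ = AddMonoidHom.id _ from DFunLike.congr_fun h y
    refine BTensor.addHom_ext fun x q => ?_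
    simp only [τ, AddMonoidHom.comp_apply, BTensor.lift'_tmul, AddMonoidHom.id_apply]
    exact ht.mapRight_sum hf hp x q

/-- The map `S ⊗_R P → S` induced by a linear form on `P`. -/
noncomputable def evalForm (hf : ∀ (r : R) (x : S), op r • x = x * f r) (φ : P →ₗ[R] R) :
    BTensor R S P →+ S :=
  BTensor.lift' (fun x p => x * f (φ p)) (fun _ _ _ => add_mul _ _ _)
    (fun _ _ _ => by rw [map_add, map_add, mul_add])
    (fun _ _ _ => by rw [hf, map_smul, smul_eq_mul, map_mul, mul_assoc])

@[simp]
theorem evalForm_tmul (hf : ∀ (r : R) (x : S), op r • x = x * f r) (φ : P →ₗ[R] R) (x : S)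
    (p : P) : evalForm hf φ (BTensor.tmul x p) = x * f (φ p) :=
  BTensor.lift'_tmul ..

theorem eq_evalForm [Module.Finite R P] [Module.Projective R P] [Module.Finite R Q]
    [Module.Projective R Q] (ht : IsInverseEntries s f t)
    (hf : ∀ (r : R) (x : S), op r • x = x * f r) {q : Q} {y : BTensor R S P}
    (hy : BTensor.mapRight s y = BTensor.tmul 1 q) (φ : P →ₗ[R] R) :
    t q φ = evalForm hf φ y := by
  obtain ⟨n, p, χ, hp⟩ := exists_finite_dual_basis R P
  rw [(ht.bijective hf).1 (hy.trans (ht.mapRight_sum hf hp 1 q).symm), map_sum]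
  simp_rw [evalForm_tmul, one_mul]
  exact (ht.sum_mul hp q φ).symm

theorem unique [Module.Finite R P] [Module.Projective R P] [Module.Finite R Q]
    [Module.Projective R Q] (ht : IsInverseEntries s f t)
    (hf : ∀ (r : R) (x : S), op r • x = x * f r) {t' : Q → (P →ₗ[R] R) → S}
    (ht' : IsInverseEntries s f t') : t = t' := by
  funext q φ
  obtain ⟨y, hy⟩ := (ht.bijective hf).2 (BTensor.tmul 1 q)
  rw [ht.eq_evalForm hf hy, ht'.eq_evalForm hf hy]

theorem exists_of_bijective (hf : ∀ (r : R) (x : S), op r • x = x * f r)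
    (hs : Function.Bijective (BTensor.mapRight (M := S) s)) :
    ∃ t, IsInverseEntries s f t := by
  let e : BTensor R S P ≃+ BTensor R S Q := AddEquiv.ofBijective _ hs
  have he (x : S) (p : P) : e.symm (BTensor.tmul x (s p)) = BTensor.tmul x p := by
    rw [AddEquiv.symm_apply_eq]; rfl
  refine ⟨fun q φ => evalForm hf φ (e.symm (BTensor.tmul 1 q)), ?_, ?_, ?_, ?_, ?_, ?_⟩
  · intro q q' φ
    rw [BTensor.tmul_add, map_add, map_add]
  · intro r q φ
    let l : S →ₗ[Rᵐᵒᵖ] S :=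
      { toFun := fun x => f r * x
        map_add' := mul_add _
        map_smul' := fun a x => by
          rw [RingHom.id_apply, ← op_unop a, hf, hf, mul_assoc] }
    have h1 : (BTensor.mapRight s).comp (BTensor.mapLeft l) =
        (BTensor.mapLeft l).comp (BTensor.mapRight (R := R) s) :=
      BTensor.addHom_ext fun _ _ => rfl
    have h2 : (evalForm hf φ).comp (BTensor.mapLeft l) =
        (AddMonoidHom.mulLeft (f r)).comp (evalForm hf φ) :=
      BTensor.addHom_ext fun x p => by simp [l, mul_assoc]
    have h3 : e.symm (BTensor.tmul 1 (r • q)) =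
        BTensor.mapLeft l (e.symm (BTensor.tmul 1 q)) := by
      rw [AddEquiv.symm_apply_eq]
      refine Eq.trans ?_ (DFunLike.congr_fun h1 _).symm
      change _ = BTensor.mapLeft l (e (e.symm _))
      rw [e.apply_symm_apply, BTensor.mapLeft_tmul, ← BTensor.smul_tmul, hf]
      simp [l]
    rw [h3]
    exact DFunLike.congr_fun h2 _
  · intro q φ φ'
    suffices h : evalForm hf (φ + φ') = evalForm hf φ + evalForm hf φ' from
      DFunLike.congr_fun h _
    exact BTensor.addHom_ext fun x p => by simp [mul_add]
  · intro r q φ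
    suffices h : evalForm hf (op r • φ) = (AddMonoidHom.mulRight (f r)).comp (evalForm hf φ) from
      DFunLike.congr_fun h _
    exact BTensor.addHom_ext fun x p => by simp [mul_assoc]
  · intro q ψ
    have h : evalForm hf (ψ ∘ₗ s) = (evalForm hf ψ).comp (BTensor.mapRight s) :=
      BTensor.addHom_ext fun x p => by simp
    rw [h]
    change evalForm hf ψ (e (e.symm _)) = _
    simp
  · intro p φ
    rw [he, evalForm_tmul, one_mul]

end IsInverseEntries

end InverseEntries

section UniversalRing

variable {R : Type u} [Ring R] {ι : Type u}
  {P Q : ι → Type u}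
  [∀ i, AddCommGroup (P i)] [∀ i, Module R (P i)]
  [∀ i, AddCommGroup (Q i)] [∀ i, Module R (Q i)]

namespace UniversalInverting

variable (R P Q) in
/-- Generators of the universal localization: the elements of `R` and formal entries of the
inverses. -/
abbrev Gen : Type u := R ⊕ (Σ i, Q i × (P i →ₗ[R] R))

variable (R P Q) in
/-- The free ring on the generators of the universal localization. -/
abbrev Free : Type u := FreeAlgebra ℤ (Gen R P Q)

/-- The generator attached to an element of `R`. -/
def coeff (r : R) : Free R P Q := FreeAlgebra.ι ℤ (Sum.inl r)

/-- The generator standing for an entry of the inverse of `1 ⊗ s i`. -/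
def entry (i : ι) (q : Q i) (φ : P i →ₗ[R] R) : Free R P Q :=
  FreeAlgebra.ι ℤ (Sum.inr ⟨i, q, φ⟩)

/-- The defining relations of the universal localization. -/
inductive Rel (s : ∀ i, P i →ₗ[R] Q i) : Free R P Q → Free R P Q → Prop
  | one : Rel s (coeff 1) 1
  | mul (a b : R) : Rel s (coeff (a * b)) (coeff a * coeff b)
  | add (a b : R) : Rel s (coeff (a + b)) (coeff a + coeff b)
  | add_left (i : ι) (q q' : Q i) (φ : P i →ₗ[R] R) :
      Rel s (entry i (q + q') φ) (entry i q φ + entry i q' φ)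
  | smul_left (i : ι) (r : R) (q : Q i) (φ : P i →ₗ[R] R) :
      Rel s (entry i (r • q) φ) (coeff r * entry i q φ)
  | add_right (i : ι) (q : Q i) (φ φ' : P i →ₗ[R] R) :
      Rel s (entry i q (φ + φ')) (entry i q φ + entry i q φ')
  | smul_right (i : ι) (r : R) (q : Q i) (φ : P i →ₗ[R] R) :
      Rel s (entry i q (op r • φ)) (entry i q φ * coeff r)
  | comp_right (i : ι) (q : Q i) (ψ : Q i →ₗ[R] R) :
      Rel s (entry i q (ψ ∘ₗ s i)) (coeff (ψ q))
  | map_left (i : ι) (p : P i) (φ : P i →ₗ[R] R) :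
      Rel s (entry i (s i p) φ) (coeff (φ p))

variable (s : ∀ i, P i →ₗ[R] Q i)

/-- The universal localization `σ⁻¹R`. -/
abbrev Loc : Type u := RingQuot (Rel s)

/-- The projection from the free ring to the universal localization. -/
noncomputable def proj : Free R P Q →+* Loc s := RingQuot.mkRingHom (Rel s)

variable {s} in
theorem proj_rel {x y : Free R P Q} (h : Rel s x y) : proj s x = proj s y :=
  RingQuot.mkRingHom_rel h

/-- The canonical map `R → σ⁻¹R`. -/
noncomputable def toLoc : R →+* Loc s :=
  RingHom.mk'
    { toFun := fun r => proj s (coeff r)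
      map_one' := (proj_rel .one).trans (map_one _)
      map_mul' := fun a b => (proj_rel (.mul a b)).trans (map_mul _ _ _) }
    fun a b => (proj_rel (.add a b)).trans (map_add _ _ _)

theorem isInverseEntries_entry (i : ι) :
    IsInverseEntries (s i) (toLoc s) fun q φ => proj s (entry i q φ) where
  add_left q q' φ := (proj_rel (.add_left i q q' φ)).trans (map_add _ _ _)
  smul_left r q φ := (proj_rel (.smul_left i r q φ)).trans (map_mul _ _ _)
  add_right q φ φ' := (proj_rel (.add_right i q φ φ')).trans (map_add _ _ _)
  smul_right r q φ := (proj_rel (.smul_right i r q φ)).trans (map_mul _ _ _)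
  comp_right q ψ := proj_rel (.comp_right i q ψ)
  map_left p φ := proj_rel (.map_left i p φ)

variable {s} {T : Type u} [Ring T]

theorem hom_ext {h h' : Loc s →+* T} (hR : h.comp (toLoc s) = h'.comp (toLoc s))
    (ht : ∀ i q φ, h (proj s (entry i q φ)) = h' (proj s (entry i q φ))) : h = h' := by
  refine RingQuot.ringQuot_ext _ _ ?_
  suffices H : (h.comp (proj s)).toIntAlgHom = (h'.comp (proj s)).toIntAlgHom from
    congrArg (fun k : Free R P Q →ₐ[ℤ] T => (k : Free R P Q →+* T)) H
  refine FreeAlgebra.hom_ext (funext fun x => ?_)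
  rcases x with r | ⟨i, q, φ⟩
  · exact DFunLike.congr_fun hR r
  · exact ht i q φ

theorem exists_hom {g : R →+* T} {t : ∀ i, Q i → (P i →ₗ[R] R) → T}
    (ht : ∀ i, IsInverseEntries (s i) g (t i)) :
    ∃ h : Loc s →+* T, g = h.comp (toLoc s) := by
  let k : Free R P Q →ₐ[ℤ] T := FreeAlgebra.lift ℤ (Sum.elim g fun x => t x.1 x.2.1 x.2.2)
  have hc (r : R) : k (coeff r) = g r := FreeAlgebra.lift_ι_apply _ _
  have he (i q φ) : k (entry i q φ) = t i q φ := FreeAlgebra.lift_ι_apply _ _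
  have hk : ∀ ⦃x y⦄, Rel s x y → (k : Free R P Q →+* T) x = (k : Free R P Q →+* T) y := by
    intro x y hxy
    change k x = k y
    cases hxy <;> simp only [map_one, map_mul, map_add, hc, he, (ht _).add_left,
      (ht _).smul_left, (ht _).add_right, (ht _).smul_right, (ht _).comp_right, (ht _).map_left]
  refine ⟨RingQuot.lift ⟨(k : Free R P Q →+* T), hk⟩, RingHom.ext fun r => ?_⟩
  exact ((RingQuot.lift_mkRingHom_apply _ hk (coeff r)).trans (hc r)).symm

end UniversalInverting

end UniversalRing

section Localization

variable {R : Type u} [Ring R] {ι : Type u}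
  {P Q : ι → Type u}
  [∀ i, AddCommGroup (P i)] [∀ i, Module R (P i)]
  [∀ i, AddCommGroup (Q i)] [∀ i, Module R (Q i)]

/-- **Cohn's theorem**: for every ring `R` and every collection `σ` of morphisms of finitely
generated projective left `R`-modules, a universally `σ`-inverting ring homomorphism
`R → σ⁻¹R` exists. -/
theorem exists_universal_inverting_ringHom
    (s : ∀ i, P i →ₗ[R] Q i)
    (hPfin : ∀ i, Module.Finite R (P i)) (hPproj : ∀ i, Module.Projective R (P i))
    (hQfin : ∀ i, Module.Finite R (Q i)) (hQproj : ∀ i, Module.Projective R (Q i)) :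
    ∃ (S : Type u) (_ : Ring S) (_ : Module Rᵐᵒᵖ S) (f : R →+* S),
      IsUniversalInverting s S f := by
  let f := UniversalInverting.toLoc s
  let : Module Rᵐᵒᵖ (UniversalInverting.Loc s) := Module.compHom _ f.op
  have hf : ∀ (r : R) (x : UniversalInverting.Loc s), op r • x = x * f r := fun _ _ => rfl
  have he := UniversalInverting.isInverseEntries_entry s
  refine ⟨UniversalInverting.Loc s, inferInstance, inferInstance, f,
    ⟨hf, fun i => (he i).bijective hf⟩, fun T _ _ g hg => ?_⟩
  choose t ht using fun i => IsInverseEntries.exists_of_bijective hg.1 (hg.2 i)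
  obtain ⟨h, rfl⟩ := UniversalInverting.exists_hom ht
  refine ⟨h, rfl, fun h' hh' => UniversalInverting.hom_ext hh'.symm fun i q φ => ?_⟩
  have h1 := (he i).comp h'
  change h.comp f = h'.comp f at hh'
  rw [← hh'] at h1
  exact congrFun (congrFun (h1.unique hg.1 ((he i).comp h)) q) φ

end Localization
end

section
/- Let f : R → σ⁻¹R be a universally σ-inverting ring homomorphism and let 0 → T' → T → T'' → 0 be a short exact sequence of left R-modules. If T and T'' are (R,σ)-modules, then T' is an (R,σ)-module; and if T' and T'' are (R,σ)-modules, then T is an (R,σ)-module. -/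
open MulOpposite

universe u

section Localization

variable {R : Type u} [Ring R] {ι : Type u}
  {P Q : ι → Type u}
  [∀ i, AddCommGroup (P i)] [∀ i, Module R (P i)]
  [∀ i, AddCommGroup (Q i)] [∀ i, Module R (Q i)]

/-- An `(R,σ)`-module (with respect to the localization `S = σ⁻¹R`): a left `R`-module `T`
admitting an exact sequence `0 → P₀ → Q₀ → T → 0` of left `R`-modules in which `P₀` and `Q₀`
are finitely generated projective and the map `P₀ → Q₀` becomes bijective after applying
`σ⁻¹R ⊗_R -`. -/
def IsRSigmaModule (R : Type u) [Ring R] (S : Type u) [Ring S] [Module Rᵐᵒᵖ S]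
    (T : Type u) [AddCommGroup T] [Module R T] : Prop :=
  ∃ (P₀ Q₀ : Type u) (_ : AddCommGroup P₀) (_ : Module R P₀)
    (_ : AddCommGroup Q₀) (_ : Module R Q₀),
    Module.Finite R P₀ ∧ Module.Projective R P₀ ∧
    Module.Finite R Q₀ ∧ Module.Projective R Q₀ ∧
    ∃ (t : P₀ →ₗ[R] Q₀) (p : Q₀ →ₗ[R] T),
      Function.Injective t ∧ Function.Surjective p ∧
      (∀ x, p x = 0 ↔ x ∈ Set.range t) ∧
      Function.Bijective (BTensor.mapRight (M := S) t)

section MapRightFunctoriality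

variable {M : Type u} [AddCommGroup M] [Module Rᵐᵒᵖ M]
  {N N' N'' : Type u} [AddCommGroup N] [Module R N] [AddCommGroup N'] [Module R N']
  [AddCommGroup N''] [Module R N'']

theorem BTensor.mapRight_tmul_s6 (g : N →ₗ[R] N') (m : M) (n : N) :
    BTensor.mapRight g (BTensor.tmul (R := R) m n) = BTensor.tmul m (g n) := rfl

theorem BTensor.addHom_ext_s6 {A : Type u} [AddCommGroup A] {a b : BTensor R M N →+ A}
    (hab : ∀ m n, a (BTensor.tmul m n) = b (BTensor.tmul m n)) : a = b := by
  refine QuotientAddGroup.addMonoidHom_ext _ (AddMonoidHom.ext fun x => ?_)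
  induction x with
  | zero => simp
  | tmul m n => exact hab m n
  | add x y hx hy => rw [map_add, map_add, hx, hy]

theorem BTensor.mapRight_id (z : BTensor R M N) :
    BTensor.mapRight (LinearMap.id (R := R)) z = z :=
  DFunLike.congr_fun (BTensor.addHom_ext_s6
    (a := BTensor.mapRight LinearMap.id) (b := AddMonoidHom.id _) fun _ _ => rfl) z

theorem BTensor.mapRight_comp (k : N' →ₗ[R] N'') (g : N →ₗ[R] N') (z : BTensor R M N) :
    BTensor.mapRight (k ∘ₗ g) z = BTensor.mapRight k (BTensor.mapRight g z) := by
  rw [← AddMonoidHom.comp_apply]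
  refine DFunLike.congr_fun (BTensor.addHom_ext_s6 fun m n => ?_) z
  simp only [AddMonoidHom.comp_apply, mapRight_tmul_s6, LinearMap.comp_apply]

theorem BTensor.mapRight_add (k g : N →ₗ[R] N') (z : BTensor R M N) :
    BTensor.mapRight (k + g) z = BTensor.mapRight k z + BTensor.mapRight g z :=
  DFunLike.congr_fun (BTensor.addHom_ext_s6
    (b := BTensor.mapRight k + BTensor.mapRight g) fun m n => by
      rw [AddMonoidHom.add_apply, mapRight_tmul_s6, mapRight_tmul_s6, mapRight_tmul_s6,
        LinearMap.add_apply, BTensor.tmul, TensorProduct.tmul_add]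
      rfl) z

theorem BTensor.mapRight_zero (z : BTensor R M N) :
    BTensor.mapRight (0 : N →ₗ[R] N') z = 0 := by
  have h := BTensor.mapRight_add (0 : N →ₗ[R] N') 0 z
  rwa [add_zero, left_eq_add] at h

/-- An element of `M ⊗ (N × N')` is determined by its two components. -/
theorem BTensor.prod_decomp (z : BTensor R M (N × N')) :
    BTensor.mapRight (LinearMap.inl R N N') (BTensor.mapRight (LinearMap.fst R N N') z) +
      BTensor.mapRight (LinearMap.inr R N N') (BTensor.mapRight (LinearMap.snd R N N') z) = z := by
  rw [← mapRight_comp, ← mapRight_comp, ← mapRight_add]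
  convert BTensor.mapRight_id z using 3
  apply LinearMap.ext
  simp

/-- A block triangular map becomes bijective once its diagonal blocks do. -/
theorem BTensor.mapRight_triangular_bijective {P₁ P₂ Q₁ Q₂ : Type u}
    [AddCommGroup P₁] [Module R P₁] [AddCommGroup P₂] [Module R P₂]
    [AddCommGroup Q₁] [Module R Q₁] [AddCommGroup Q₂] [Module R Q₂]
    (t₁ : P₁ →ₗ[R] Q₁) (t₂ : P₂ →ₗ[R] Q₂) (m : P₂ →ₗ[R] Q₁)
    (h₁ : Function.Bijective (BTensor.mapRight (M := M) t₁))
    (h₂ : Function.Bijective (BTensor.mapRight (M := M) t₂)) :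
    Function.Bijective (BTensor.mapRight (M := M)
      ((t₁.coprod m).prod (t₂ ∘ₗ LinearMap.snd R P₁ P₂))) := by
  set k := (t₁.coprod m).prod (t₂ ∘ₗ LinearMap.snd R P₁ P₂) with hk
  have hfst (z : BTensor R M (P₁ × P₂)) :
      BTensor.mapRight (LinearMap.fst R Q₁ Q₂) (BTensor.mapRight k z) =
        BTensor.mapRight t₁ (BTensor.mapRight (LinearMap.fst R P₁ P₂) z) +
          BTensor.mapRight m (BTensor.mapRight (LinearMap.snd R P₁ P₂) z) := by
    simp only [← mapRight_comp, ← mapRight_add]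
    congr 2
  have hsnd (z : BTensor R M (P₁ × P₂)) :
      BTensor.mapRight (LinearMap.snd R Q₁ Q₂) (BTensor.mapRight k z) =
        BTensor.mapRight t₂ (BTensor.mapRight (LinearMap.snd R P₁ P₂) z) := by
    simp only [← mapRight_comp]
    congr 2
  constructor
  · rw [injective_iff_map_eq_zero]
    intro z hz
    have e₂ : BTensor.mapRight (LinearMap.snd R P₁ P₂) z = 0 := by
      apply h₂.1
      rw [← hsnd, hz, map_zero, map_zero]
    have e₁ : BTensor.mapRight (LinearMap.fst R P₁ P₂) z = 0 := by
      apply h₁.1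
      have := hfst z
      rw [hz, e₂, map_zero, map_zero, add_zero] at this
      rw [← this, map_zero]
    rw [← prod_decomp z, e₁, e₂, map_zero, map_zero, add_zero]
  · intro w
    obtain ⟨b, hb⟩ := h₂.2 (BTensor.mapRight (LinearMap.snd R Q₁ Q₂) w)
    obtain ⟨a, ha⟩ := h₁.2 (BTensor.mapRight (LinearMap.fst R Q₁ Q₂) w - BTensor.mapRight m b)
    set z := BTensor.mapRight (LinearMap.inl R P₁ P₂) a +
      BTensor.mapRight (LinearMap.inr R P₁ P₂) b with hz
    have za : BTensor.mapRight (LinearMap.fst R P₁ P₂) z = a := by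
      rw [hz, map_add, ← mapRight_comp, ← mapRight_comp, LinearMap.fst_comp_inl,
        LinearMap.fst_comp_inr, mapRight_id, mapRight_zero, add_zero]
    have zb : BTensor.mapRight (LinearMap.snd R P₁ P₂) z = b := by
      rw [hz, map_add, ← mapRight_comp, ← mapRight_comp, LinearMap.snd_comp_inl,
        LinearMap.snd_comp_inr, mapRight_id, mapRight_zero, zero_add]
    refine ⟨z, ?_⟩
    rw [← prod_decomp (BTensor.mapRight k z), hfst, hsnd, za, zb, ha, hb, sub_add_cancel,
      prod_decomp]

end MapRightFunctoriality

section ShortExact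

variable {S : Type u} [Ring S] [Module Rᵐᵒᵖ S]
  {T' T T'' : Type u} [AddCommGroup T'] [Module R T'] [AddCommGroup T] [Module R T]
  [AddCommGroup T''] [Module R T'']

/-- A map whose values lie in the range of an injective map factors through it. -/
theorem LinearMap.exists_comp_eq_of_forall_mem_range {A B C : Type*} [AddCommGroup A] [Module R A]
    [AddCommGroup B] [Module R B] [AddCommGroup C] [Module R C] (g : A →ₗ[R] B)
    (hg : Function.Injective g) (k : C →ₗ[R] B) (hk : ∀ c, k c ∈ Set.range g) :
    ∃ l : C →ₗ[R] A, ∀ c, g (l c) = k c := by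
  refine ⟨(LinearEquiv.ofInjective g hg).symm.toLinearMap ∘ₗ
    k.codRestrict (LinearMap.range g) hk, fun c => ?_⟩
  have := (LinearEquiv.ofInjective g hg).apply_symm_apply
    (k.codRestrict (LinearMap.range g) hk c)
  exact congrArg Subtype.val this

theorem IsRSigmaModule.left_of_shortExact
    (g : T' →ₗ[R] T) (h : T →ₗ[R] T'')
    (hg : Function.Injective g) (hh : Function.Surjective h)
    (hex : ∀ x, h x = 0 ↔ x ∈ Set.range g)
    (hT : IsRSigmaModule R S T) (hT'' : IsRSigmaModule R S T'') : IsRSigmaModule R S T' := by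
  obtain ⟨P, Q, _, _, _, _, _, _, _, _, t, p, ht, hp, htp, hS⟩ := hT
  obtain ⟨P₂, Q₂, _, _, _, _, _, _, _, _, t₂, p₂, ht₂, hp₂, htp₂, hS₂⟩ := hT''
  obtain ⟨l, hl⟩ := Module.projective_lifting_property p₂ (h ∘ₗ p) hp₂
  replace hl : ∀ q, p₂ (l q) = h (p q) := LinearMap.congr_fun hl
  obtain ⟨m, hm⟩ := LinearMap.exists_comp_eq_of_forall_mem_range t₂ ht₂ (l ∘ₗ t) fun x => by
    rw [← htp₂, LinearMap.comp_apply, hl, (htp _).2 ⟨x, rfl⟩, map_zero]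
  replace hm : ∀ x, t₂ (m x) = l (t x) := hm
  let φ : Q × P₂ →ₗ[R] Q₂ := l.coprod (-t₂)
  have hφ (a : Q) (b : P₂) : φ (a, b) = 0 ↔ l a = t₂ b := by
    simp [φ, ← sub_eq_add_neg, sub_eq_zero]
  have hφs : Function.Surjective φ := by
    intro w
    obtain ⟨x, hx⟩ := hh (p₂ w)
    obtain ⟨q, rfl⟩ := hp x
    obtain ⟨b, hb⟩ := (htp₂ (l q - w)).1 (by rw [map_sub, hl, hx, sub_self])
    exact ⟨(q, b), by simp [φ, hb]⟩
  obtain ⟨c, hc⟩ := Module.projective_lifting_property φ LinearMap.id hφs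
  replace hc : ∀ w, φ (c w) = w := LinearMap.congr_fun hc
  let K := LinearMap.ker φ
  let i : K →ₗ[R] Q × P₂ := K.subtype
  let r : Q × P₂ →ₗ[R] K := (LinearMap.id - c ∘ₗ φ).codRestrict K fun x => by
    simp [K, hc]
  have hri : r ∘ₗ i = LinearMap.id := by
    ext1 x
    apply Subtype.ext
    have : φ (i x) = 0 := x.2
    change i x - c (φ (i x)) = i x
    rw [this, map_zero, sub_zero]
  have hK (x : K) : l x.1.1 = t₂ x.1.2 := (hφ _ _).1 x.2
  let u : P →ₗ[R] K := (t.prod m).codRestrict K fun x => (hφ _ _).2 (hm x).symm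
  obtain ⟨v, hv⟩ := LinearMap.exists_comp_eq_of_forall_mem_range g hg
    (p ∘ₗ LinearMap.fst R Q P₂ ∘ₗ i) fun x => by
      rw [← hex]
      change h (p x.1.1) = 0
      rw [← hl, hK, htp₂]
      exact ⟨_, rfl⟩
  replace hv : ∀ x : K, g (v x) = p x.1.1 := hv
  have hu : (LinearMap.fst R Q P₂ ∘ₗ i) ∘ₗ u = t := rfl
  refine ⟨P, K, inferInstance, inferInstance, inferInstance, inferInstance, inferInstance,
    inferInstance, Module.Finite.of_surjective r fun x => ⟨i x, LinearMap.congr_fun hri x⟩,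
    Module.Projective.of_split i r hri, u, v, ?_, ?_, ?_, ?_⟩
  · exact fun x y hxy => ht (congrArg (fun z : K => z.1.1) hxy)
  · intro y
    obtain ⟨q, hq⟩ := hp (g y)
    obtain ⟨b, hb⟩ := (htp₂ (l q)).1 (by rw [hl, hq]; exact (hex _).2 ⟨y, rfl⟩)
    exact ⟨⟨(q, b), (hφ _ _).2 hb.symm⟩, hg (by rw [hv, hq])⟩
  · intro x
    rw [← map_eq_zero_iff g hg, hv, htp]
    constructor
    · rintro ⟨y, hy⟩
      refine ⟨y, Subtype.ext (Prod.ext hy (ht₂ ?_))⟩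
      rw [← hK x, ← hy]
      exact hm y
    · rintro ⟨y, rfl⟩
      exact ⟨y, rfl⟩
  · have hinj : Function.Injective
        (BTensor.mapRight (M := S) (LinearMap.fst R Q P₂ ∘ₗ i)) := by
      rw [injective_iff_map_eq_zero]
      intro z hz
      have hsnd : BTensor.mapRight (LinearMap.snd R Q P₂ ∘ₗ i) z = 0 := by
        apply hS₂.1
        have : t₂ ∘ₗ LinearMap.snd R Q P₂ ∘ₗ i = l ∘ₗ LinearMap.fst R Q P₂ ∘ₗ i :=
          LinearMap.ext fun x => (hK x).symm
        rw [← BTensor.mapRight_comp, this, BTensor.mapRight_comp, hz, map_zero, map_zero]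
      rw [BTensor.mapRight_comp] at hz hsnd
      have hiz : BTensor.mapRight i z = 0 := by
        rw [← BTensor.prod_decomp (BTensor.mapRight i z), hz, hsnd, map_zero, map_zero, add_zero]
      rw [← BTensor.mapRight_id z, ← hri, BTensor.mapRight_comp, hiz, map_zero]
    have hcomp : BTensor.mapRight (M := S) (LinearMap.fst R Q P₂ ∘ₗ i) ∘
        BTensor.mapRight (M := S) u = BTensor.mapRight (M := S) t :=
      funext fun z => by rw [Function.comp_apply, ← BTensor.mapRight_comp, hu]
    rw [← hcomp] at hS
    refine ⟨hS.1.of_comp, fun y => ?_⟩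
    obtain ⟨x, hx⟩ := hS.2 (BTensor.mapRight (LinearMap.fst R Q P₂ ∘ₗ i) y)
    exact ⟨x, hinj hx⟩

theorem IsRSigmaModule.middle_of_shortExact
    (g : T' →ₗ[R] T) (h : T →ₗ[R] T'')
    (hg : Function.Injective g) (hh : Function.Surjective h)
    (hex : ∀ x, h x = 0 ↔ x ∈ Set.range g)
    (hT' : IsRSigmaModule R S T') (hT'' : IsRSigmaModule R S T'') : IsRSigmaModule R S T := by
  obtain ⟨P₁, Q₁, _, _, _, _, _, _, _, _, t₁, p₁, ht₁, hp₁, htp₁, hS₁⟩ := hT'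
  obtain ⟨P₂, Q₂, _, _, _, _, _, _, _, _, t₂, p₂, ht₂, hp₂, htp₂, hS₂⟩ := hT''
  obtain ⟨l, hl⟩ := Module.projective_lifting_property h p₂ hh
  replace hl : ∀ q, h (l q) = p₂ q := LinearMap.congr_fun hl
  obtain ⟨k, hk⟩ := LinearMap.exists_comp_eq_of_forall_mem_range g hg (l ∘ₗ t₂) fun y => by
    rw [← hex, LinearMap.comp_apply, hl, htp₂]
    exact ⟨y, rfl⟩
  replace hk : ∀ y, g (k y) = l (t₂ y) := hk
  obtain ⟨m, hm⟩ := Module.projective_lifting_property p₁ (-k) hp₁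
  replace hm : ∀ y, p₁ (m y) = -k y := LinearMap.congr_fun hm
  have hgp (x : P₁) : p₁ (t₁ x) = 0 := (htp₁ _).2 ⟨x, rfl⟩
  refine ⟨P₁ × P₂, Q₁ × Q₂, inferInstance, inferInstance, inferInstance, inferInstance,
    inferInstance, inferInstance, inferInstance, inferInstance,
    (t₁.coprod m).prod (t₂ ∘ₗ LinearMap.snd R P₁ P₂), (g ∘ₗ p₁).coprod l, ?_, ?_, ?_,
    BTensor.mapRight_triangular_bijective t₁ t₂ m hS₁ hS₂⟩
  · rw [injective_iff_map_eq_zero]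
    rintro ⟨x, y⟩ hxy
    obtain ⟨h₁, h₂⟩ : t₁ x + m y = 0 ∧ t₂ y = 0 := by simpa using hxy
    obtain rfl : y = 0 := (map_eq_zero_iff t₂ ht₂).1 h₂
    rw [map_zero, add_zero, map_eq_zero_iff t₁ ht₁] at h₁
    rw [h₁, Prod.mk_zero_zero]
  · intro x
    obtain ⟨b, hb⟩ := hp₂ (h x)
    obtain ⟨y, hy⟩ := (hex (x - l b)).1 (by rw [map_sub, hl, hb, sub_self])
    obtain ⟨a, rfl⟩ := hp₁ y
    exact ⟨(a, b), by simp [hy]⟩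
  · rintro ⟨a, b⟩
    constructor
    · intro hab
      replace hab : g (p₁ a) + l b = 0 := by simpa using hab
      have hb := congrArg h hab
      rw [map_add, (hex (g (p₁ a))).2 ⟨_, rfl⟩, zero_add, hl, map_zero] at hb
      obtain ⟨y, rfl⟩ := (htp₂ b).1 hb
      obtain ⟨x, hx⟩ := (htp₁ (a - m y)).1 (hg (by
        rw [map_sub, hm, sub_neg_eq_add, map_add, hk, hab, map_zero]))
      exact ⟨(x, y), by simp [hx]⟩
    · rintro ⟨⟨x, y⟩, hxy⟩
      rw [← hxy]
      simp [hgp, hm, hk]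

end ShortExact

/-- Given a universally `σ`-inverting `f : R → σ⁻¹R` and a short exact sequence
`0 → T' → T → T'' → 0` of left `R`-modules: if `T` and `T''` are `(R,σ)`-modules then so is
`T'`, and if `T'` and `T''` are `(R,σ)`-modules then so is `T`. -/
theorem isRSigmaModule_of_shortExact
    (s : ∀ i, P i →ₗ[R] Q i)
    (hPfin : ∀ i, Module.Finite R (P i)) (hPproj : ∀ i, Module.Projective R (P i))
    (hQfin : ∀ i, Module.Finite R (Q i)) (hQproj : ∀ i, Module.Projective R (Q i))
    (S : Type u) [Ring S] [Module Rᵐᵒᵖ S] (f : R →+* S)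
    (huniv : IsUniversalInverting s S f)
    (T' T T'' : Type u) [AddCommGroup T'] [Module R T'] [AddCommGroup T] [Module R T]
    [AddCommGroup T''] [Module R T'']
    (g : T' →ₗ[R] T) (h : T →ₗ[R] T'')
    (hg : Function.Injective g) (hh : Function.Surjective h)
    (hex : ∀ x, h x = 0 ↔ x ∈ Set.range g) :
    (IsRSigmaModule R S T → IsRSigmaModule R S T'' → IsRSigmaModule R S T') ∧
    (IsRSigmaModule R S T' → IsRSigmaModule R S T'' → IsRSigmaModule R S T) := by
  exact ⟨IsRSigmaModule.left_of_shortExact g h hg hh hex,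
    IsRSigmaModule.middle_of_shortExact g h hg hh hex⟩

end Localization
end
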